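/- Let 0 < α ≤ 1 and γ > 1. Then the number of distinct partitions of X that are (α,γ)-clusterings is at most f(α,γ) = 2·(12·(2γ² − γ + 1) / (α²·(γ−1)²))^{(√8·γ·(γ²+1)/((γ−1)²·α))²·ln(1/α)}. -/

import Mathlib

open Finset
open scoped Classical

/-- `P(A)`: the probability mass of a finite set `A`. -/
noncomputable def pOf {X : Type*} (P : X → ℝ) (A : Finset X) : ℝ := ∑ x ∈ A, P x

/-- `Δ(x,A)`: the average distance from `x` to `A`,
weighted by the probability mass function `P` restricted to `A`. -/
noncomputable def Dpt {X : Type*} [MetricSpace X] (P : X → ℝ) (x : X) (A : Finset X) : ℝ :=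
  (∑ y ∈ A, P y * dist x y) / pOf P A

/-- An unordered family `Fam` of subsets of `X` is an `(α,γ)`-clustering: it is a partition of `X`
into nonempty pairwise disjoint parts, each of probability at least `α`, such that
`Δ(x,C') ≥ γ·Δ(x,C)` whenever `C ≠ C'` are parts and `x ∈ C`. -/
def IsClusteringFam {X : Type*} [Fintype X] [MetricSpace X] (P : X → ℝ) (α γ : ℝ)
    (Fam : Finset (Finset X)) : Prop :=
  (∀ C ∈ Fam, C.Nonempty) ∧
  (∀ C ∈ Fam, ∀ C' ∈ Fam, C ≠ C' → Disjoint C C') ∧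
  (∀ x : X, ∃ C ∈ Fam, x ∈ C) ∧
  (∀ C ∈ Fam, α ≤ pOf P C) ∧
  (∀ C ∈ Fam, ∀ C' ∈ Fam, C ≠ C' → ∀ x ∈ C, γ * Dpt P x C ≤ Dpt P x C')

/-- The set of points carrying the label `j`. -/
noncomputable def labelFiber {X : Type*} [Fintype X] {k : ℕ} (c : X → Fin k) (j : Fin k) :
    Finset X :=
  Finset.univ.filter (fun x => c x = j)

/-- A labelling whose fibres form an `(α,γ)`-clustering. -/
def IsClusteringLabel {X : Type*} [Fintype X] [MetricSpace X] {k : ℕ} (P : X → ℝ) (α γ : ℝ)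
    (c : X → Fin k) : Prop :=
  (∀ j, α ≤ pOf P (labelFiber c j)) ∧
  ∀ x j, j ≠ c x → γ * Dpt P x (labelFiber c (c x)) ≤ Dpt P x (labelFiber c j)

theorem mem_labelFiber {X : Type*} [Fintype X] {k : ℕ} (c : X → Fin k) (j : Fin k) (x : X) :
    x ∈ labelFiber c j ↔ c x = j := by
  simp [labelFiber]

theorem Dpt_mul_pOf {X : Type*} [MetricSpace X] {P : X → ℝ} {A : Finset X}
    (hA : 0 < pOf P A) (x : X) : Dpt P x A * pOf P A = ∑ y ∈ A, P y * dist x y :=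
  div_mul_cancel₀ _ hA.ne'

theorem Dpt_nonneg {X : Type*} [MetricSpace X] {P : X → ℝ} (hP : ∀ x, 0 < P x) (x : X)
    (A : Finset X) : 0 ≤ Dpt P x A :=
  div_nonneg (Finset.sum_nonneg fun y _ => mul_nonneg (hP y).le dist_nonneg)
    (Finset.sum_nonneg fun y _ => (hP y).le)

theorem Dpt_le_dist_add_Dpt {X : Type*} [MetricSpace X] {P : X → ℝ} (hP : ∀ x, 0 < P x)
    {A : Finset X} (hA : 0 < pOf P A) (x y : X) : Dpt P x A ≤ dist x y + Dpt P y A := by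
  refine le_of_mul_le_mul_right ?_ hA
  rw [add_mul, Dpt_mul_pOf hA, Dpt_mul_pOf hA, pOf, Finset.mul_sum, ← Finset.sum_add_distrib]
  refine Finset.sum_le_sum fun z _ => ?_
  nlinarith [hP z, dist_triangle x y z]

theorem dist_le_Dpt_add_Dpt {X : Type*} [MetricSpace X] {P : X → ℝ} (hP : ∀ x, 0 < P x)
    {A : Finset X} (hA : 0 < pOf P A) (x y : X) : dist x y ≤ Dpt P x A + Dpt P y A := by
  refine le_of_mul_le_mul_right ?_ hA
  rw [add_mul, Dpt_mul_pOf hA, Dpt_mul_pOf hA, pOf, Finset.mul_sum, ← Finset.sum_add_distrib]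
  refine Finset.sum_le_sum fun z _ => ?_
  nlinarith [hP z, dist_triangle_right x y z]

theorem Dpt_pos_of_notMem {X : Type*} [MetricSpace X] {P : X → ℝ} (hP : ∀ x, 0 < P x)
    {A : Finset X} (hA : 0 < pOf P A) {x : X} (hx : x ∉ A) : 0 < Dpt P x A := by
  refine div_pos (Finset.sum_pos (fun y hy => mul_pos (hP y) (dist_pos.2 ?_)) ?_) hA
  · rintro rfl
    exact hx hy
  · rw [Finset.nonempty_iff_ne_empty]
    rintro rfl
    simp [pOf] at hA

/-- All distances from `x` to points of its own cluster or of another cluster `C` are controlled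
by the average distance from `x` to `C`. -/
theorem IsClusteringLabel.dist_le {X : Type*} [Fintype X] [MetricSpace X] {k : ℕ} {P : X → ℝ}
    (hP : ∀ x, 0 < P x) {α γ R : ℝ} (hα : 0 < α) (hγ : 1 < γ)
    (hR : R * (γ * (γ - 1)) = γ ^ 2 + 1) {c : X → Fin k} (hc : IsClusteringLabel P α γ c)
    {x z : X} {j : Fin k} (hj : j ≠ c x) (hz : c z = j ∨ c z = c x) :
    dist x z ≤ R * Dpt P x (labelFiber c j) := by
  have hpos : ∀ l, 0 < pOf P (labelFiber c l) := fun l => hα.trans_le (hc.1 l)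
  have hD := Dpt_nonneg hP x (labelFiber c j)
  have hx := hc.2 x j hj
  have hg : 0 < γ * (γ - 1) := by nlinarith
  suffices h : γ * (γ - 1) * dist x z ≤ (γ ^ 2 + 1) * Dpt P x (labelFiber c j) by
    rw [← hR] at h
    refine le_of_mul_le_mul_left ?_ hg
    linarith
  rcases hz with hz | hz
  · have h1 := hc.2 z (c x) (by rw [hz]; exact hj.symm)
    rw [hz] at h1
    have h2 := Dpt_le_dist_add_Dpt hP (hpos (c x)) z x
    rw [dist_comm] at h2
    have h4 := dist_le_Dpt_add_Dpt hP (hpos j) x z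
    have h5 := mul_le_mul_of_nonneg_left h4 (by positivity : 0 ≤ γ ^ 2)
    have h6 := mul_le_mul_of_nonneg_left (h1.trans h2) (by positivity : 0 ≤ γ)
    nlinarith
  · have h1 := hc.2 z j (by rw [hz]; exact hj)
    rw [hz] at h1
    have h2 := Dpt_le_dist_add_Dpt hP (hpos j) z x
    rw [dist_comm] at h2
    have h4 := dist_le_Dpt_add_Dpt hP (hpos (c x)) x z
    have h5 : (γ - 1) * dist x z ≤ 2 * Dpt P x (labelFiber c j) := by nlinarith
    have h6 := mul_le_mul_of_nonneg_left h5 (by positivity : 0 ≤ γ)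
    nlinarith [mul_nonneg (sq_nonneg (γ - 1)) hD]

/-- One half of the rigidity of clusterings: two clusterings differing on a set of small mass
cannot disagree on a point whose distance to the other cluster is larger in the first one. -/
theorem IsClusteringLabel.false_of_disagree {X : Type*} [Fintype X] [MetricSpace X] {k : ℕ}
    {P : X → ℝ} (hP : ∀ x, 0 < P x) {α γ δ : ℝ} (hα : 0 < α) (hγ : 1 < γ)
    (hδ : δ * (γ * (γ + 1)) < α * (γ - 1) ^ 2) {c c' : X → Fin k}
    (hc : IsClusteringLabel P α γ c) (hc' : IsClusteringLabel P α γ c')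
    (hcc : ∑ x ∈ Finset.univ.filter (fun x => c x ≠ c' x), P x ≤ δ) {x : X} (hx : c x ≠ c' x)
    (hle : Dpt P x (labelFiber c' (c x)) ≤ Dpt P x (labelFiber c (c' x))) : False := by
  obtain ⟨R, hR⟩ : ∃ R : ℝ, R * (γ * (γ - 1)) = γ ^ 2 + 1 :=
    ⟨(γ ^ 2 + 1) / (γ * (γ - 1)), div_mul_cancel₀ _ (by nlinarith)⟩
  have hR0 : 0 ≤ R := by
    by_contra! h
    nlinarith [mul_pos (by linarith : 0 < γ) (by linarith : 0 < γ - 1)]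
  set j := c' x with hj
  set A := labelFiber c j with hA
  set A' := labelFiber c' j with hA'
  set D := Dpt P x A with hD
  have hApos : 0 < pOf P A := hα.trans_le (hc.1 j)
  have hA'pos : 0 < pOf P A' := hα.trans_le (hc'.1 j)
  have hDpos : 0 < D := Dpt_pos_of_notMem hP hApos (by rw [mem_labelFiber]; exact hx)
  have hD' : γ * Dpt P x A' ≤ D := (hc'.2 x (c x) hx).trans hle
  have hsub : A \ A' ⊆ Finset.univ.filter (fun x => c x ≠ c' x) := by
    intro y
    simp only [hA, hA', Finset.mem_sdiff, mem_labelFiber, Finset.mem_filter, Finset.mem_univ,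
      true_and]
    rintro ⟨h1, h2⟩
    rw [h1]
    exact Ne.symm h2
  have hsub' : A' \ A ⊆ Finset.univ.filter (fun x => c x ≠ c' x) := by
    intro y
    simp only [hA, hA', Finset.mem_sdiff, mem_labelFiber, Finset.mem_filter, Finset.mem_univ,
      true_and]
    rintro ⟨h1, h2⟩
    rw [h1]
    exact h2
  have hm : ∑ y ∈ A \ A', P y ≤ δ :=
    (Finset.sum_le_sum_of_subset_of_nonneg hsub fun y _ _ => (hP y).le).trans hcc
  have hm' : ∑ y ∈ A' \ A, P y ≤ δ :=
    (Finset.sum_le_sum_of_subset_of_nonneg hsub' fun y _ _ => (hP y).le).trans hcc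
  have hmass : pOf P A' ≤ pOf P A + δ := by
    have h1 := Finset.sum_inter_add_sum_sdiff A' A P
    have h2 : ∑ y ∈ A' ∩ A, P y ≤ pOf P A :=
      Finset.sum_le_sum_of_subset_of_nonneg Finset.inter_subset_right fun y _ _ => (hP y).le
    rw [pOf]
    linarith
  have hdist : D * pOf P A ≤ Dpt P x A' * pOf P A' + δ * (R * D) := by
    rw [hD, Dpt_mul_pOf hApos, Dpt_mul_pOf hA'pos, ← Finset.sum_inter_add_sum_sdiff A A']
    refine add_le_add (Finset.sum_le_sum_of_subset_of_nonneg Finset.inter_subset_right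
      fun y _ _ => mul_nonneg (hP y).le dist_nonneg) ?_
    calc ∑ y ∈ A \ A', P y * dist x y ≤ ∑ y ∈ A \ A', P y * (R * D) := by
          refine Finset.sum_le_sum fun y hy => mul_le_mul_of_nonneg_left ?_ (hP y).le
          refine hc.dist_le hP hα hγ hR hx.symm (Or.inl ?_)
          exact (mem_labelFiber _ _ _).1 (Finset.mem_sdiff.1 hy).1
      _ = (∑ y ∈ A \ A', P y) * (R * D) := by rw [Finset.sum_mul]
      _ ≤ δ * (R * D) := mul_le_mul_of_nonneg_right hm (by positivity)
  have h1 : γ * Dpt P x A' * pOf P A' ≤ D * (pOf P A + δ) :=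
    (mul_le_mul_of_nonneg_right hD' hA'pos.le).trans
      (mul_le_mul_of_nonneg_left hmass hDpos.le)
  have h2 : D * (γ * pOf P A) ≤ D * (pOf P A + δ + γ * (δ * R)) := by nlinarith
  have h3 := le_of_mul_le_mul_left h2 hDpos
  have h4 : (γ - 1) * α ≤ δ + γ * (δ * R) := by nlinarith [hc.1 j]
  have h5 := mul_le_mul_of_nonneg_right h4 (by linarith : 0 ≤ γ - 1)
  have h6 : (δ + γ * (δ * R)) * (γ - 1) = δ * (γ * (γ + 1)) := by
    linear_combination δ * hR
  nlinarith

theorem IsClusteringLabel.eq_of_mass_le {X : Type*} [Fintype X] [MetricSpace X] {k : ℕ}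
    {P : X → ℝ} (hP : ∀ x, 0 < P x) {α γ δ : ℝ} (hα : 0 < α) (hγ : 1 < γ)
    (hδ : δ * (γ * (γ + 1)) < α * (γ - 1) ^ 2) {c c' : X → Fin k}
    (hc : IsClusteringLabel P α γ c) (hc' : IsClusteringLabel P α γ c')
    (hcc : ∑ x ∈ Finset.univ.filter (fun x => c x ≠ c' x), P x ≤ δ) : c = c' := by
  funext x
  by_contra hx
  rcases le_total (Dpt P x (labelFiber c' (c x))) (Dpt P x (labelFiber c (c' x))) with h | h
  · exact hc.false_of_disagree hP hα hγ hδ hc' hcc hx h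
  · refine hc'.false_of_disagree hP hα hγ hδ hc ?_ (Ne.symm hx) h
    simpa only [ne_comm] using hcc

/-- A second-order bound on the moment generating function of a bounded nonnegative variable. -/
theorem sum_mul_exp_le {ι : Type*} (s : Finset ι) (w d : ι → ℝ) (hw : ∀ i ∈ s, 0 ≤ w i)
    (hw1 : ∑ i ∈ s, w i = 1) {M θ h : ℝ} (hd : ∀ i ∈ s, 0 ≤ d i) (hdM : ∀ i ∈ s, d i ≤ M)
    (hθ : |θ| * M = h) (hh : h ≤ 1) :
    ∑ i ∈ s, w i * Real.exp (θ * d i) ≤ Real.exp ((θ + |θ| * h) * ∑ i ∈ s, w i * d i) := by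
  have key : ∀ i ∈ s, w i * Real.exp (θ * d i) ≤ w i + (θ + |θ| * h) * (w i * d i) := by
    intro i hi
    have h0 := hd i hi
    have h1 : |θ| * d i ≤ h := hθ ▸ mul_le_mul_of_nonneg_left (hdM i hi) (abs_nonneg θ)
    have h2 : |θ * d i| = |θ| * d i := by rw [abs_mul, abs_of_nonneg h0]
    have h3 := (abs_le.1 (Real.abs_exp_sub_one_sub_id_le (x := θ * d i)
      (by rw [h2]; linarith))).2
    have h4 : (θ * d i) ^ 2 ≤ |θ| * h * d i := by
      rw [← sq_abs, h2]
      have := mul_le_mul_of_nonneg_left h1 (mul_nonneg (abs_nonneg θ) h0)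
      nlinarith
    have h5 : Real.exp (θ * d i) ≤ 1 + (θ + |θ| * h) * d i := by linarith
    have := mul_le_mul_of_nonneg_left h5 (hw i hi)
    linarith
  calc _ ≤ ∑ i ∈ s, (w i + (θ + |θ| * h) * (w i * d i)) := Finset.sum_le_sum key
    _ = (θ + |θ| * h) * ∑ i ∈ s, w i * d i + 1 := by
        rw [Finset.sum_add_distrib, hw1, Finset.mul_sum, add_comm]
    _ ≤ _ := Real.add_one_le_exp _

theorem sum_mul_exp_dist_le {X : Type*} [MetricSpace X] {P : X → ℝ} (hP : ∀ x, 0 < P x)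
    {A : Finset X} (hA : 0 < pOf P A) (x : X) {M θ h : ℝ} (hM : ∀ y ∈ A, dist x y ≤ M)
    (hθ : |θ| * M = h) (hh : h ≤ 1) :
    ∑ y ∈ A, P y * Real.exp (θ * dist x y) ≤
      pOf P A * Real.exp ((θ + |θ| * h) * Dpt P x A) := by
  have h1 := sum_mul_exp_le A (fun y => P y / pOf P A) (fun y => dist x y)
    (fun y _ => div_nonneg (hP y).le hA.le)
    (by rw [← Finset.sum_div]; exact div_self hA.ne') (fun _ _ => dist_nonneg) hM hθ hh
  simp only [div_mul_eq_mul_div, ← Finset.sum_div] at h1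
  rwa [div_le_iff₀ hA, mul_comm (Real.exp _)] at h1

/-- The samples taking `s` points from each cluster. -/
noncomputable def clusterSamples {X : Type*} [Fintype X] {k : ℕ} (c : X → Fin k) (s : ℕ) :
    Finset (Fin k × Fin s → X) :=
  Fintype.piFinset fun i => labelFiber c i.1

/-- A sample places `x` closer, on average, to the points drawn for label `j` than to those drawn
for label `i`. -/
def Prefers {X : Type*} [MetricSpace X] {k s : ℕ} (z : Fin k × Fin s → X) (x : X)
    (i j : Fin k) : Prop :=
  ∑ t, dist x (z (j, t)) ≤ ∑ t, dist x (z (i, t))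

theorem IsClusteringLabel.sum_prefers_le {X : Type*} [Fintype X] [MetricSpace X] {k : ℕ}
    {P : X → ℝ} (hP : ∀ x, 0 < P x) {α γ R h : ℝ} (hα : 0 < α) (hγ : 1 < γ)
    (hR : R * (γ * (γ - 1)) = γ ^ 2 + 1) (hh : 4 * h * γ = γ - 1) {c : X → Fin k}
    (hc : IsClusteringLabel P α γ c) (s : ℕ) {x : X} {j : Fin k} (hj : j ≠ c x) :
    ∑ z ∈ (clusterSamples c s).filter (fun z => Prefers z x (c x) j), ∏ i, P (z i) ≤
      Real.exp (-(s * (2 * h ^ 2 / R))) * ∑ z ∈ clusterSamples c s, ∏ i, P (z i) := by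
  have hg : 0 < γ * (γ - 1) := by nlinarith
  have hR0 : 0 < R := by
    by_contra! h
    nlinarith
  have hh0 : 0 < h := by
    by_contra! h
    nlinarith
  have hh1 : h ≤ 1 := by
    by_contra! h
    nlinarith
  have hpos : ∀ l, 0 < pOf P (labelFiber c l) := fun l => hα.trans_le (hc.1 l)
  set D := Dpt P x (labelFiber c j) with hD
  have hDpos : 0 < D := Dpt_pos_of_notMem hP (hpos j) (by rw [mem_labelFiber]; exact hj.symm)
  obtain ⟨lam, hlam⟩ : ∃ lam : ℝ, lam * (R * D) = h :=
    ⟨h / (R * D), div_mul_cancel₀ _ (by positivity)⟩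
  have hlam0 : 0 < lam := by
    by_contra! h
    nlinarith [mul_pos hR0 hDpos]
  obtain ⟨θ, hθi, hθj, hθ⟩ : ∃ θ : Fin k → ℝ, θ (c x) = lam ∧ θ j = -lam ∧
      ∀ l, l ≠ c x → l ≠ j → θ l = 0 :=
    ⟨fun l => if l = c x then lam else if l = j then -lam else 0, by simp, by simp [hj],
      fun l h1 h2 => by simp [h1, h2]⟩
  have hsum : ∀ f : Fin k → ℝ, (∀ l, l ≠ c x → l ≠ j → f l = 0) → ∑ l, f l = f (c x) + f j :=
    fun f hf => Finset.sum_eq_add (c x) j hj.symm (fun l _ hl => hf l hl.1 hl.2)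
      (fun h => absurd (Finset.mem_univ _) h) (fun h => absurd (Finset.mem_univ _) h)
  set φ : Fin k → ℝ := fun l => (θ l + |θ l| * h) * Dpt P x (labelFiber c l) with hφ
  have hmgf : ∀ l, ∑ y ∈ labelFiber c l, P y * Real.exp (θ l * dist x y) ≤
      pOf P (labelFiber c l) * Real.exp (φ l) := by
    intro l
    by_cases hl : l = c x ∨ l = j
    · refine sum_mul_exp_dist_le hP (hpos l) x (M := R * D) (fun y hy => ?_) ?_ hh1
      · rw [mem_labelFiber] at hy
        refine hc.dist_le hP hα hγ hR hj ?_
        rw [hy]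
        exact hl.symm
      · rcases hl with rfl | rfl
        · rw [hθi, abs_of_pos hlam0, hlam]
        · rw [hθj, abs_neg, abs_of_pos hlam0, hlam]
    · push Not at hl
      simp [hφ, hθ l hl.1 hl.2, pOf]
  have hexp : ∑ l, φ l ≤ -(2 * h ^ 2 / R) := by
    rw [hsum φ fun l h1 h2 => by simp [hφ, hθ l h1 h2]]
    simp only [hφ, hθi, hθj, abs_neg, abs_of_pos hlam0]
    have h1 := hc.2 x j hj
    have h2 : 2 * h ^ 2 / R = 2 * h * (lam * D) := by
      rw [div_eq_iff hR0.ne']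
      linear_combination -2 * h * hlam
    rw [h2]
    have h3 : Dpt P x (labelFiber c (c x)) ≤ (1 - 4 * h) * D := by
      refine le_of_mul_le_mul_left (a := γ) ?_ (by linarith)
      have : γ * ((1 - 4 * h) * D) = D := by linear_combination -D * hh
      rw [this]
      exact h1
    have h4 := mul_le_mul_of_nonneg_left h3 (by positivity : 0 ≤ lam * (1 + h))
    have h5 : 0 ≤ lam * D * h ^ 2 := by positivity
    rw [← hD]
    nlinarith
  have hterm : ∀ z ∈ clusterSamples c s, 0 ≤ ∏ i, P (z i) :=
    fun z _ => Finset.prod_nonneg fun i _ => (hP _).le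
  calc ∑ z ∈ (clusterSamples c s).filter (fun z => Prefers z x (c x) j), ∏ i, P (z i)
      ≤ ∑ z ∈ (clusterSamples c s).filter (fun z => Prefers z x (c x) j),
          ∏ i, P (z i) * Real.exp (θ i.1 * dist x (z i)) := by
        refine Finset.sum_le_sum fun z hz => ?_
        rw [Finset.mem_filter] at hz
        rw [Finset.prod_mul_distrib, ← Real.exp_sum]
        refine le_mul_of_one_le_right (hterm z hz.1) (Real.one_le_exp ?_)
        rw [Fintype.sum_prod_type]
        simp only [← Finset.mul_sum]
        rw [hsum _ fun l h1 h2 => by simp [hθ l h1 h2], hθi, hθj]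
        have := mul_le_mul_of_nonneg_left hz.2 hlam0.le
        linarith
    _ ≤ ∑ z ∈ clusterSamples c s, ∏ i, P (z i) * Real.exp (θ i.1 * dist x (z i)) :=
        Finset.sum_le_sum_of_subset_of_nonneg (Finset.filter_subset _ _) fun z _ _ =>
          Finset.prod_nonneg fun i _ => mul_nonneg (hP _).le (Real.exp_nonneg _)
    _ = ∏ i : Fin k × Fin s, ∑ y ∈ labelFiber c i.1, P y * Real.exp (θ i.1 * dist x y) :=
        (Finset.prod_univ_sum (fun i : Fin k × Fin s => labelFiber c i.1)
          (fun i y => P y * Real.exp (θ i.1 * dist x y))).symm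
    _ ≤ ∏ i : Fin k × Fin s, (pOf P (labelFiber c i.1) * Real.exp (φ i.1)) :=
        Finset.prod_le_prod (fun i _ => Finset.sum_nonneg fun y _ =>
          mul_nonneg (hP _).le (Real.exp_nonneg _)) fun i _ => hmgf i.1
    _ = Real.exp (s * ∑ l, φ l) * ∑ z ∈ clusterSamples c s, ∏ i, P (z i) := by
        rw [Finset.prod_mul_distrib, ← Real.exp_sum, Fintype.sum_prod_type, mul_comm]
        congr 1
        · simp [Finset.mul_sum]
        · exact Finset.prod_univ_sum (fun i : Fin k × Fin s => labelFiber c i.1) (fun _ y => P y)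
    _ ≤ _ := by
        refine mul_le_mul_of_nonneg_right (Real.exp_le_exp.2 ?_) (Finset.sum_nonneg hterm)
        rw [← mul_neg]
        exact mul_le_mul_of_nonneg_left hexp (Nat.cast_nonneg s)

/-- The points which the sample `z` does not assign to their label under `c`. -/
noncomputable def misplaced {X : Type*} [Fintype X] [MetricSpace X] {k s : ℕ} (c : X → Fin k)
    (z : Fin k × Fin s → X) : Finset X :=
  Finset.univ.filter fun x => ∃ j, j ≠ c x ∧ Prefers z x (c x) j

/-- The samples from the clusters of `c` which recover `c` up to mass `ε`. -/
noncomputable def recoveringSamples {X : Type*} [Fintype X] [MetricSpace X] {k : ℕ} (P : X → ℝ)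
    (ε : ℝ) (c : X → Fin k) (s : ℕ) : Finset (Fin k × Fin s → X) :=
  (clusterSamples c s).filter fun z => ∑ x ∈ misplaced c z, P x ≤ ε

theorem IsClusteringLabel.sum_mass_misplaced_le {X : Type*} [Fintype X] [MetricSpace X] {k : ℕ}
    {P : X → ℝ} (hP : ∀ x, 0 < P x) (hsum : ∑ x, P x = 1) {α γ R h : ℝ} (hα : 0 < α)
    (hγ : 1 < γ) (hR : R * (γ * (γ - 1)) = γ ^ 2 + 1) (hh : 4 * h * γ = γ - 1) {c : X → Fin k}
    (hc : IsClusteringLabel P α γ c) (s : ℕ) :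
    ∑ z ∈ clusterSamples c s, (∏ i, P (z i)) * ∑ x ∈ misplaced c z, P x ≤
      k * (Real.exp (-(s * (2 * h ^ 2 / R))) * ∑ z ∈ clusterSamples c s, ∏ i, P (z i)) := by
  set Q := Real.exp (-(s * (2 * h ^ 2 / R))) * ∑ z ∈ clusterSamples c s, ∏ i, P (z i) with hQ
  have hW : ∀ z : Fin k × Fin s → X, 0 ≤ ∏ i, P (z i) :=
    fun z => Finset.prod_nonneg fun i _ => (hP _).le
  have hQ0 : 0 ≤ Q := mul_nonneg (Real.exp_nonneg _) (Finset.sum_nonneg fun z _ => hW z)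
  have hx : ∀ x, ∑ z ∈ clusterSamples c s, (if x ∈ misplaced c z then ∏ i, P (z i) else 0) ≤
      k * Q := by
    intro x
    calc _ ≤ ∑ z ∈ clusterSamples c s, ∑ j : Fin k,
            (if j ≠ c x ∧ Prefers z x (c x) j then ∏ i, P (z i) else 0) := by
          refine Finset.sum_le_sum fun z _ => ?_
          have hnn : ∀ j ∈ (Finset.univ : Finset (Fin k)),
              0 ≤ if j ≠ c x ∧ Prefers z x (c x) j then ∏ i, P (z i) else 0 := by
            intro j _
            split_ifs
            exacts [hW z, le_rfl]
          split_ifs with hm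
          · obtain ⟨j, hj⟩ := (Finset.mem_filter.1 hm).2
            have := Finset.single_le_sum hnn (Finset.mem_univ j)
            rwa [if_pos hj] at this
          · exact Finset.sum_nonneg hnn
      _ = ∑ j : Fin k, ∑ z ∈ clusterSamples c s,
            (if j ≠ c x ∧ Prefers z x (c x) j then ∏ i, P (z i) else 0) := Finset.sum_comm
      _ ≤ ∑ _j : Fin k, Q := by
          refine Finset.sum_le_sum fun j _ => ?_
          by_cases hj : j = c x
          · simpa [hj] using hQ0
          · simp only [ne_eq, hj, not_false_eq_true, true_and, ← Finset.sum_filter]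
            exact hc.sum_prefers_le hP hα hγ hR hh s hj
      _ = k * Q := by simp
  calc _ = ∑ z ∈ clusterSamples c s, ∑ x,
          P x * (if x ∈ misplaced c z then ∏ i, P (z i) else 0) := by
        refine Finset.sum_congr rfl fun z _ => ?_
        simp only [mul_ite, mul_zero, Finset.sum_ite_mem, Finset.univ_inter, ← Finset.sum_mul]
        exact mul_comm _ _
    _ = ∑ x, P x * ∑ z ∈ clusterSamples c s, (if x ∈ misplaced c z then ∏ i, P (z i) else 0) := by
        rw [Finset.sum_comm]
        simp only [Finset.mul_sum]
    _ ≤ ∑ x, P x * (k * Q) :=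
        Finset.sum_le_sum fun x _ => mul_le_mul_of_nonneg_left (hx x) (hP x).le
    _ = k * Q := by rw [← Finset.sum_mul, hsum, one_mul]

theorem IsClusteringLabel.le_sum_recoveringSamples {X : Type*} [Fintype X] [MetricSpace X]
    {k : ℕ} {P : X → ℝ} (hP : ∀ x, 0 < P x) (hsum : ∑ x, P x = 1) {α γ R h ε : ℝ} (hα : 0 < α)
    (hγ : 1 < γ) (hR : R * (γ * (γ - 1)) = γ ^ 2 + 1) (hh : 4 * h * γ = γ - 1) {c : X → Fin k}
    (hc : IsClusteringLabel P α γ c) (s : ℕ) (hε : 0 < ε)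
    (hs : k * Real.exp (-(s * (2 * h ^ 2 / R))) ≤ ε / 2) :
    α ^ (k * s) / 2 ≤ ∑ z ∈ recoveringSamples P ε c s, ∏ i, P (z i) := by
  have hW : ∀ z : Fin k × Fin s → X, 0 ≤ ∏ i, P (z i) :=
    fun z => Finset.prod_nonneg fun i _ => (hP _).le
  have htot : α ^ (k * s) ≤ ∑ z ∈ clusterSamples c s, ∏ i, P (z i) := by
    have h1 := Finset.prod_univ_sum (fun i : Fin k × Fin s => labelFiber c i.1) (fun _ y => P y)
    rw [clusterSamples, ← h1]
    calc α ^ (k * s) = ∏ _i : Fin k × Fin s, α := by simp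
      _ ≤ _ := Finset.prod_le_prod (fun _ _ => hα.le) fun i _ => hc.1 i.1
  have hmass := hc.sum_mass_misplaced_le hP hsum hα hγ hR hh s
  have hsplit := Finset.sum_filter_add_sum_filter_not (clusterSamples c s)
    (fun z => ∑ x ∈ misplaced c z, P x ≤ ε) (fun z => ∏ i, P (z i))
  set T := ∑ z ∈ clusterSamples c s, ∏ i, P (z i) with hT
  have hT0 : 0 ≤ T := Finset.sum_nonneg fun z _ => hW z
  set F := ∑ z ∈ (clusterSamples c s).filter (fun z => ¬ ∑ x ∈ misplaced c z, P x ≤ ε),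
    ∏ i, P (z i) with hF
  have hmarkov : F * ε ≤
      ∑ z ∈ clusterSamples c s, (∏ i, P (z i)) * ∑ x ∈ misplaced c z, P x := by
    rw [hF, Finset.sum_mul]
    refine (Finset.sum_le_sum fun z hz => ?_).trans
      (Finset.sum_le_sum_of_subset_of_nonneg (Finset.filter_subset _ _) fun z _ _ =>
        mul_nonneg (hW z) (Finset.sum_nonneg fun x _ => (hP x).le))
    exact mul_le_mul_of_nonneg_left (not_le.1 (Finset.mem_filter.1 hz).2).le (hW z)
  have h1 : F * ε ≤ T / 2 * ε := by
    have := mul_le_mul_of_nonneg_right hs hT0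
    linarith
  have h2 := le_of_mul_le_mul_right h1 hε
  rw [recoveringSamples]
  linarith

theorem disjoint_recoveringSamples {X : Type*} [Fintype X] [MetricSpace X] {k : ℕ} {P : X → ℝ}
    (hP : ∀ x, 0 < P x) {α γ ε : ℝ} (hα : 0 < α) (hγ : 1 < γ)
    (hε : 2 * ε * (γ * (γ + 1)) < α * (γ - 1) ^ 2) {c c' : X → Fin k}
    (hc : IsClusteringLabel P α γ c) (hc' : IsClusteringLabel P α γ c') (hne : c ≠ c') (s : ℕ) :
    Disjoint (recoveringSamples P ε c s) (recoveringSamples P ε c' s) := by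
  rw [Finset.disjoint_left]
  intro z hz hz'
  have h1 := (Finset.mem_filter.1 hz).2
  have h2 := (Finset.mem_filter.1 hz').2
  refine hne (hc.eq_of_mass_le hP hα hγ hε hc' ?_)
  have hsub : Finset.univ.filter (fun x => c x ≠ c' x) ⊆ misplaced c z ∪ misplaced c' z := by
    intro x hx
    have hx := (Finset.mem_filter.1 hx).2
    simp only [misplaced, Finset.mem_union, Finset.mem_filter, Finset.mem_univ, true_and]
    rcases le_total (∑ t, dist x (z (c x, t))) (∑ t, dist x (z (c' x, t))) with h | h
    · exact Or.inr ⟨c x, hx, h⟩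
    · exact Or.inl ⟨c' x, hx.symm, h⟩
  have h3 := Finset.sum_le_sum_of_subset_of_nonneg hsub fun x _ _ => (hP x).le
  have h4 := Finset.sum_union_inter (s₁ := misplaced c z) (s₂ := misplaced c' z) (f := P)
  have h5 : 0 ≤ ∑ x ∈ misplaced c z ∩ misplaced c' z, P x :=
    Finset.sum_nonneg fun x _ => (hP x).le
  linarith

/-- The number of labelled clusterings with `k` clusters. -/
theorem card_isClusteringLabel_le {X : Type*} [Fintype X] [MetricSpace X] {P : X → ℝ}
    (hP : ∀ x, 0 < P x) (hsum : ∑ x, P x = 1) {α γ R h ε : ℝ} (hα : 0 < α)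
    (hγ : 1 < γ) (hR : R * (γ * (γ - 1)) = γ ^ 2 + 1) (hh : 4 * h * γ = γ - 1) (k s : ℕ)
    (hε : 0 < ε) (hs : k * Real.exp (-(s * (2 * h ^ 2 / R))) ≤ ε / 2)
    (hε' : 2 * ε * (γ * (γ + 1)) < α * (γ - 1) ^ 2) :
    ((Finset.univ.filter fun c : X → Fin k => IsClusteringLabel P α γ c).card : ℝ) ≤
      2 * (1 / α) ^ (k * s) := by
  set L := Finset.univ.filter fun c : X → Fin k => IsClusteringLabel P α γ c with hL
  have hW : ∀ z : Fin k × Fin s → X, 0 ≤ ∏ i, P (z i) :=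
    fun z => Finset.prod_nonneg fun i _ => (hP _).le
  have h1 : L.card * (α ^ (k * s) / 2) ≤
      ∑ c ∈ L, ∑ z ∈ recoveringSamples P ε c s, ∏ i, P (z i) := by
    rw [← nsmul_eq_mul, ← Finset.sum_const]
    exact Finset.sum_le_sum fun c hc =>
      (Finset.mem_filter.1 hc).2.le_sum_recoveringSamples hP hsum hα hγ hR hh s hε hs
  have h2 : ∑ c ∈ L, ∑ z ∈ recoveringSamples P ε c s, ∏ i, P (z i) ≤ 1 := by
    rw [← Finset.sum_biUnion fun c hc c' hc' hne => disjoint_recoveringSamples hP hα hγ hε'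
      (Finset.mem_filter.1 hc).2 (Finset.mem_filter.1 hc').2 hne s]
    calc _ ≤ ∑ z : Fin k × Fin s → X, ∏ i, P (z i) :=
          Finset.sum_le_sum_of_subset_of_nonneg (Finset.subset_univ _) fun z _ _ => hW z
      _ = ∏ _i : Fin k × Fin s, ∑ y, P y := by
          rw [Finset.prod_univ_sum, Fintype.piFinset_univ]
      _ = 1 := by simp [hsum]
  have h3 := h1.trans h2
  have h4 : 0 < α ^ (k * s) := by positivity
  rw [one_div, inv_pow, ← div_eq_mul_inv, le_div_iff₀ h4]
  linarith

/-- Every clustering is the family of fibres of some labelling. -/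
theorem IsClusteringFam.exists_label {X : Type*} [Fintype X] [MetricSpace X] {P : X → ℝ}
    {α γ : ℝ} {Fam : Finset (Finset X)} (hF : IsClusteringFam P α γ Fam) :
    ∃ c : X → Fin Fam.card, IsClusteringLabel P α γ c ∧
      Finset.univ.image (labelFiber c) = Fam := by
  obtain ⟨-, hdisj, hcov, hmass, hsep⟩ := hF
  choose p hp hmem using hcov
  have huniq : ∀ x, ∀ C ∈ Fam, x ∈ C → p x = C := by
    intro x C hC hx
    by_contra hne
    exact Finset.disjoint_left.1 (hdisj _ (hp x) _ hC hne) (hmem x) hx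
  let e := Fam.equivFin
  have hfib : ∀ j, labelFiber (fun x => e ⟨p x, hp x⟩) j = (e.symm j : Finset X) := by
    intro j
    ext x
    rw [mem_labelFiber, ← Equiv.eq_symm_apply, Subtype.ext_iff]
    constructor
    · intro h
      rw [← h]
      exact hmem x
    · exact huniq x _ (e.symm j).2
  refine ⟨fun x => e ⟨p x, hp x⟩, ⟨fun j => ?_, fun x j hj => ?_⟩, ?_⟩
  · rw [hfib]
    exact hmass _ (e.symm j).2
  · rw [hfib, hfib, Equiv.symm_apply_apply]
    refine hsep _ (hp x) _ (e.symm j).2 (fun h => hj ?_) x (hmem x)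
    rw [← Equiv.symm_apply_eq, Subtype.ext_iff]
    exact h.symm
  · ext C
    simp only [Finset.mem_image, Finset.mem_univ, true_and, hfib]
    constructor
    · rintro ⟨j, rfl⟩
      exact (e.symm j).2
    · exact fun hC => ⟨e ⟨C, hC⟩, by simp⟩

theorem IsClusteringFam.card_mul_le_one {X : Type*} [Fintype X] [MetricSpace X] {P : X → ℝ}
    (hP : ∀ x, 0 < P x) (hsum : ∑ x, P x = 1) {α γ : ℝ} {Fam : Finset (Finset X)}
    (hF : IsClusteringFam P α γ Fam) : Fam.card * α ≤ 1 := by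
  rw [← hsum, ← nsmul_eq_mul, ← Finset.sum_const]
  calc ∑ _C ∈ Fam, α ≤ ∑ C ∈ Fam, ∑ x ∈ C, P x := Finset.sum_le_sum hF.2.2.2.1
    _ = ∑ x ∈ Fam.biUnion id, P x :=
        (Finset.sum_biUnion fun C hC C' hC' hne => hF.2.1 C hC C' hC' hne).symm
    _ ≤ ∑ x, P x :=
        Finset.sum_le_sum_of_subset_of_nonneg (Finset.subset_univ _) fun x _ _ => (hP x).le

theorem card_isClusteringFam_le {X : Type*} [Fintype X] [MetricSpace X] {P : X → ℝ}
    (hP : ∀ x, 0 < P x) (hsum : ∑ x, P x = 1) {α γ : ℝ} (hα : 0 < α) (hα1 : α ≤ 1) (s : ℕ)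
    (hlab : ∀ k : ℕ, k * α ≤ 1 →
      ((Finset.univ.filter fun c : X → Fin k => IsClusteringLabel P α γ c).card : ℝ) ≤
        2 * (1 / α) ^ (k * s)) :
    ((Finset.univ.filter (fun Fam : Finset (Finset X) => IsClusteringFam P α γ Fam)).card : ℝ) ≤
      2 * (1 / α) ^ ((s + 1) / α) := by
  have hα' : 1 ≤ 1 / α := by rwa [one_le_div hα]
  have hK : ∀ k : ℕ, k ≤ ⌊1 / α⌋₊ → (k : ℝ) ≤ 1 / α := fun k hk =>
    (Nat.le_floor_iff (by positivity)).1 hk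
  have hX : Nonempty X := by
    by_contra h
    rw [not_nonempty_iff] at h
    simp at hsum
  have hsub : Finset.univ.filter (fun Fam : Finset (Finset X) => IsClusteringFam P α γ Fam) ⊆
      (Finset.Icc 1 ⌊1 / α⌋₊).biUnion fun k =>
        (Finset.univ.filter fun c : X → Fin k => IsClusteringLabel P α γ c).image
          fun c => Finset.univ.image (labelFiber c) := by
    intro Fam hFam
    have hF := (Finset.mem_filter.1 hFam).2
    obtain ⟨c, hc, hc'⟩ := hF.exists_label
    rw [Finset.mem_biUnion]
    refine ⟨Fam.card, Finset.mem_Icc.2 ⟨Fin.pos (c hX.some), ?_⟩,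
      Finset.mem_image.2 ⟨c, Finset.mem_filter.2 ⟨Finset.mem_univ _, hc⟩, hc'⟩⟩
    rw [Nat.le_floor_iff (by positivity), le_div_iff₀ hα]
    exact hF.card_mul_le_one hP hsum
  have h1 : ((Finset.univ.filter
      (fun Fam : Finset (Finset X) => IsClusteringFam P α γ Fam)).card : ℝ) ≤
      ∑ k ∈ Finset.Icc 1 ⌊1 / α⌋₊,
        ((Finset.univ.filter fun c : X → Fin k => IsClusteringLabel P α γ c).card : ℝ) := by
    exact_mod_cast (Finset.card_le_card hsub).trans (Finset.card_biUnion_le.trans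
      (Finset.sum_le_sum fun k _ => Finset.card_image_le))
  refine h1.trans ?_
  calc _ ≤ ∑ _k ∈ Finset.Icc 1 ⌊1 / α⌋₊, 2 * (1 / α) ^ (s / α) := by
        refine Finset.sum_le_sum fun k hk => ?_
        have hk' := hK k (Finset.mem_Icc.1 hk).2
        refine (hlab k (by rwa [← le_div_iff₀ hα])).trans ?_
        rw [← Real.rpow_natCast]
        refine mul_le_mul_of_nonneg_left (Real.rpow_le_rpow_of_exponent_le hα' ?_) two_pos.le
        push_cast
        have := mul_le_mul_of_nonneg_right hk' (Nat.cast_nonneg s : (0 : ℝ) ≤ s)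
        rwa [one_div_mul_eq_div] at this
    _ = ⌊1 / α⌋₊ * (2 * (1 / α) ^ (s / α)) := by simp
    _ ≤ (1 / α) ^ (1 / α) * (2 * (1 / α) ^ (s / α)) := by
        refine mul_le_mul_of_nonneg_right ((hK _ le_rfl).trans ?_) (by positivity)
        exact Real.self_le_rpow_of_one_le hα' hα'
    _ = 2 * (1 / α) ^ ((s + 1) / α) := by
        rw [add_div, Real.rpow_add (by positivity)]
        ring

theorem add_one_div_le_exponent {α γ V l s : ℝ} (hα : 0 < α) (hα1 : α ≤ 1) (hγ : 1 < γ)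
    (hV : V = 8 * γ * (γ ^ 2 + 1) / (γ - 1) ^ 3) (hV8 : 8 ≤ V) (hl : 1 ≤ l)
    (hs : s < V * l + 1) :
    (s + 1) / α ≤ (Real.sqrt 8 * γ * (γ ^ 2 + 1) / ((γ - 1) ^ 2 * α)) ^ 2 * l := by
  have hγ0 : 0 < γ := by linarith
  have hγ1 : 0 < γ - 1 := by linarith
  set E := (Real.sqrt 8 * γ * (γ ^ 2 + 1) / ((γ - 1) ^ 2 * α)) ^ 2 with hE
  have hEV : E * α ^ 2 = V * (γ * (γ ^ 2 + 1) / (γ - 1)) := by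
    rw [hE, hV, div_pow, mul_pow, mul_pow, Real.sq_sqrt (by norm_num)]
    field_simp
  have hEα : 2 * V / α ≤ E := by
    rw [div_le_iff₀ hα]
    refine le_of_mul_le_mul_right ?_ hα
    have h1 : 2 ≤ γ * (γ ^ 2 + 1) / (γ - 1) := by
      rw [le_div_iff₀ hγ1]
      nlinarith
    have h2 : V * 2 ≤ V * (γ * (γ ^ 2 + 1) / (γ - 1)) :=
      mul_le_mul_of_nonneg_left h1 (by linarith)
    have h3 : 2 * V * α ≤ 2 * V := mul_le_of_le_one_right (by linarith) hα1
    linarith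
  have h8 : 8 * 1 ≤ V * l := mul_le_mul hV8 hl zero_le_one (by linarith)
  calc (s + 1) / α ≤ 2 * V * l / α := div_le_div_of_nonneg_right (by linarith) hα.le
    _ = 2 * V / α * l := by ring
    _ ≤ _ := mul_le_mul_of_nonneg_right hEα (by linarith)

/-- The number of distinct `(α,γ)`-clusterings of any finite metric probability space is at most
`f(α,γ) = 2·(12(2γ²−γ+1)/(α²(γ−1)²))^((√8·γ(γ²+1)/((γ−1)²α))²·ln(1/α))`. -/
theorem stmt_6 {X : Type*} [Fintype X] [MetricSpace X] [DecidableEq X]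
    (P : X → ℝ) (hP : ∀ x, 0 < P x) (hsum : ∑ x, P x = 1)
    (α γ : ℝ) (hα : 0 < α) (hα1 : α ≤ 1) (hγ : 1 < γ) :
    ((Finset.univ.filter (fun Fam : Finset (Finset X) => IsClusteringFam P α γ Fam)).card : ℝ) ≤
      2 * (12 * (2 * γ ^ 2 - γ + 1) / (α ^ 2 * (γ - 1) ^ 2)) ^
        ((Real.sqrt 8 * γ * (γ ^ 2 + 1) / ((γ - 1) ^ 2 * α)) ^ 2 * Real.log (1 / α)) := by
  have hγ0 : 0 < γ := by linarith
  have hγ1 : 0 < γ - 1 := by linarith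
  have hq : 0 < 2 * γ ^ 2 - γ + 1 := by nlinarith
  set B := 12 * (2 * γ ^ 2 - γ + 1) / (α ^ 2 * (γ - 1) ^ 2) with hB
  have hB0 : 0 < B := by positivity
  have hBmul : B * (α ^ 2 * (γ - 1) ^ 2) = 12 * (2 * γ ^ 2 - γ + 1) :=
    div_mul_cancel₀ _ (by positivity)
  have hlogB : 1 ≤ Real.log B := by
    rw [Real.le_log_iff_exp_le hB0, hB, le_div_iff₀ (by positivity)]
    have h1 : α ^ 2 * (γ - 1) ^ 2 ≤ (γ - 1) ^ 2 :=
      mul_le_of_le_one_left (by positivity) (by nlinarith)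
    have h2 := mul_le_mul Real.exp_one_lt_three.le h1 (by positivity) (by norm_num)
    nlinarith
  obtain ⟨R, hRdef⟩ : ∃ R, R = (γ ^ 2 + 1) / (γ * (γ - 1)) := ⟨_, rfl⟩
  obtain ⟨h, hhdef⟩ : ∃ h, h = (γ - 1) / (4 * γ) := ⟨_, rfl⟩
  obtain ⟨V, hVdef⟩ : ∃ V, V = 8 * γ * (γ ^ 2 + 1) / (γ - 1) ^ 3 := ⟨_, rfl⟩
  have hR : R * (γ * (γ - 1)) = γ ^ 2 + 1 := by
    rw [hRdef]
    exact div_mul_cancel₀ _ (by positivity)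
  have hh : 4 * h * γ = γ - 1 := by
    rw [hhdef]
    field_simp
  have hV : V * (2 * h ^ 2 / R) = 1 := by
    rw [hVdef, hhdef, hRdef]
    field_simp
    norm_num
  have hV8 : 8 ≤ V := by
    rw [hVdef, le_div_iff₀ (by positivity)]
    nlinarith
  have hrate : 0 < 2 * h ^ 2 / R := by
    rw [hRdef, hhdef]
    positivity
  have hs := Nat.le_ceil (V * Real.log B)
  have hs' := Nat.ceil_lt_add_one (a := V * Real.log B) (by positivity)
  set s := ⌈V * Real.log B⌉₊
  have hexp : Real.exp (-(s * (2 * h ^ 2 / R))) ≤ 1 / B := by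
    rw [one_div, ← Real.exp_log (inv_pos.2 hB0), Real.log_inv]
    refine Real.exp_le_exp.2 (neg_le_neg ?_)
    calc Real.log B = V * Real.log B * (2 * h ^ 2 / R) := by linear_combination -Real.log B * hV
      _ ≤ _ := mul_le_mul_of_nonneg_right hs hrate.le
  have hcount := card_isClusteringFam_le (γ := γ) hP hsum hα hα1 s fun k hk => by
    refine card_isClusteringLabel_le hP hsum hα hγ hR hh k s (ε := 2 / (α * B))
      (by positivity) ?_ ?_
    · calc (k : ℝ) * Real.exp (-(s * (2 * h ^ 2 / R))) ≤ 1 / α * (1 / B) :=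
            mul_le_mul ((le_div_iff₀ hα).2 hk) hexp (Real.exp_nonneg _) (by positivity)
        _ = 2 / (α * B) / 2 := by
            field_simp
    · have h1 : 2 / (α * B) = α * (γ - 1) ^ 2 / (6 * (2 * γ ^ 2 - γ + 1)) := by
        rw [div_eq_div_iff (by positivity) (by positivity)]
        linear_combination -hBmul
      rw [h1, mul_div_assoc', div_mul_eq_mul_div, div_lt_iff₀ (by positivity)]
      have h2 : 0 < α * (γ - 1) ^ 2 := by positivity
      have h3 : 2 * (γ * (γ + 1)) < 6 * (2 * γ ^ 2 - γ + 1) := by nlinarith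
      nlinarith [mul_lt_mul_of_pos_left h3 h2]
  have hα' : 1 ≤ 1 / α := by rwa [one_le_div hα]
  have hexponent := add_one_div_le_exponent hα hα1 hγ hVdef hV8 hlogB hs'
  set E := (Real.sqrt 8 * γ * (γ ^ 2 + 1) / ((γ - 1) ^ 2 * α)) ^ 2
  have hswap : B ^ (E * Real.log (1 / α)) = (1 / α) ^ (E * Real.log B) := by
    rw [Real.rpow_def_of_pos hB0, Real.rpow_def_of_pos (by positivity)]
    ring_nf
  rw [hswap]
  refine le_trans ?_ (hcount.trans
    (mul_le_mul_of_nonneg_left (Real.rpow_le_rpow_of_exponent_le hα' hexponent) two_pos.le))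
  exact_mod_cast Finset.card_le_card fun Fam hFam =>
    Finset.mem_filter.2 ⟨Finset.mem_univ _, (Finset.mem_filter.1 hFam).2⟩
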